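/- arXiv:2507.12246 — 3 statements merged into one kernel-verified Lean document; each statement's English description precedes it below -/
import Mathlib

section
/- (Concavity of the semi-dual) For all φ, φ̄ ∈ L¹(ν) for which J(φ) and J(φ̄) are finite, the Bregman gap of the semi-dual is non-positive: J(φ̄) − J(φ) − ⟨δJ(φ), φ̄ − φ⟩ ≤ 0, where ⟨f,g⟩ := ∫_𝒴 f(y)g(y) dy. -/
open MeasureTheory

noncomputable section

variable {d : ℕ}

/-- `φ⁺(x) = log ∫ exp(φ(y) - c(x,y)/ε) dν(y)`, with `ν` the density of the marginal on `𝒴`. -/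
def phiPlus (ν : (Fin d → ℝ) → ℝ) (c : (Fin d → ℝ) → (Fin d → ℝ) → ℝ) (ε : ℝ)
    (φ : (Fin d → ℝ) → ℝ) (x : Fin d → ℝ) : ℝ :=
  Real.log (∫ y, Real.exp (φ y - c x y / ε) * ν y)

/-- The semi-dual `J(φ) = ∫ φ dν - ∫ φ⁺ dμ`. -/
def semiDual (μ ν : (Fin d → ℝ) → ℝ) (c : (Fin d → ℝ) → (Fin d → ℝ) → ℝ) (ε : ℝ)
    (φ : (Fin d → ℝ) → ℝ) : ℝ :=
  (∫ y, φ y * ν y) - ∫ x, phiPlus ν c ε φ x * μ x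

/-- The joint density `π(φ, φ⁺)(x,y) = exp(φ(y) - φ⁺(x) - c(x,y)/ε) μ(x) ν(y)`. -/
def piJoint (μ ν : (Fin d → ℝ) → ℝ) (c : (Fin d → ℝ) → (Fin d → ℝ) → ℝ) (ε : ℝ)
    (φ : (Fin d → ℝ) → ℝ) (z : (Fin d → ℝ) × (Fin d → ℝ)) : ℝ :=
  Real.exp (φ z.2 - phiPlus ν c ε φ z.1 - c z.1 z.2 / ε) * μ z.1 * ν z.2

/-- The `𝒴`-marginal density of `π(φ, φ⁺)`. -/
def piY (μ ν : (Fin d → ℝ) → ℝ) (c : (Fin d → ℝ) → (Fin d → ℝ) → ℝ) (ε : ℝ)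
    (φ : (Fin d → ℝ) → ℝ) (y : Fin d → ℝ) : ℝ :=
  ∫ x, piJoint μ ν c ε φ (x, y)

/-- First variation of the semi-dual: `δJ(φ) = ν - π(φ,φ⁺)_𝒴`. -/
def deltaJ (μ ν : (Fin d → ℝ) → ℝ) (c : (Fin d → ℝ) → (Fin d → ℝ) → ℝ) (ε : ℝ)
    (φ : (Fin d → ℝ) → ℝ) (y : Fin d → ℝ) : ℝ :=
  ν y - piY μ ν c ε φ y

lemma measurable_phiPlus {ν : (Fin d → ℝ) → ℝ} {c : (Fin d → ℝ) → (Fin d → ℝ) → ℝ} (ε : ℝ)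
    {φ : (Fin d → ℝ) → ℝ} (hνm : Measurable ν) (hc : Measurable (Function.uncurry c))
    (hφm : Measurable φ) : Measurable (phiPlus ν c ε φ) := by
  have hc' : Measurable (fun z : (Fin d → ℝ) × (Fin d → ℝ) => c z.1 z.2) := hc
  have h : Measurable (fun z : (Fin d → ℝ) × (Fin d → ℝ) =>
      Real.exp (φ z.2 - c z.1 z.2 / ε) * ν z.2) := by fun_prop
  exact Real.measurable_log.comp h.stronglyMeasurable.integral_prod_right'.measurable

lemma measurable_piJoint {μ ν : (Fin d → ℝ) → ℝ} {c : (Fin d → ℝ) → (Fin d → ℝ) → ℝ} (ε : ℝ)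
    {φ : (Fin d → ℝ) → ℝ} (hμm : Measurable μ) (hνm : Measurable ν)
    (hc : Measurable (Function.uncurry c)) (hφm : Measurable φ) :
    Measurable (piJoint μ ν c ε φ) := by
  have hc' : Measurable (fun z : (Fin d → ℝ) × (Fin d → ℝ) => c z.1 z.2) := hc
  have hp := measurable_phiPlus ε hνm hc hφm
  unfold piJoint
  fun_prop

lemma piJoint_nonneg {μ ν : (Fin d → ℝ) → ℝ} (c : (Fin d → ℝ) → (Fin d → ℝ) → ℝ) (ε : ℝ)
    (φ : (Fin d → ℝ) → ℝ) (hμ0 : ∀ x, 0 ≤ μ x) (hν0 : ∀ y, 0 ≤ ν y)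
    (z : (Fin d → ℝ) × (Fin d → ℝ)) : 0 ≤ piJoint μ ν c ε φ z :=
  mul_nonneg (mul_nonneg (Real.exp_nonneg _) (hμ0 _)) (hν0 _)

lemma piJoint_mk (μ ν : (Fin d → ℝ) → ℝ) (c : (Fin d → ℝ) → (Fin d → ℝ) → ℝ) (ε : ℝ)
    (φ : (Fin d → ℝ) → ℝ) (x y : Fin d → ℝ) :
    piJoint μ ν c ε φ (x, y) = (Real.exp (phiPlus ν c ε φ x))⁻¹ * μ x *
      (Real.exp (φ y - c x y / ε) * ν y) := by
  have h : φ y - phiPlus ν c ε φ x - c x y / ε =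
      -phiPlus ν c ε φ x + (φ y - c x y / ε) := by ring
  simp only [piJoint, h, Real.exp_add, Real.exp_neg]
  ring

lemma integrable_piJoint_right (μ : (Fin d → ℝ) → ℝ) {ν : (Fin d → ℝ) → ℝ}
    {c : (Fin d → ℝ) → (Fin d → ℝ) → ℝ} {ε : ℝ} {φ : (Fin d → ℝ) → ℝ} {x : Fin d → ℝ}
    (hpos : 0 < ∫ y, Real.exp (φ y - c x y / ε) * ν y) :
    Integrable (fun y => piJoint μ ν c ε φ (x, y)) := by
  simp only [piJoint_mk]
  exact (Integrable.of_integral_ne_zero hpos.ne').const_mul _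

/-- The `𝒳`-marginal of `π(φ, φ⁺)` is `μ`. -/
lemma integral_piJoint_right (μ : (Fin d → ℝ) → ℝ) {ν : (Fin d → ℝ) → ℝ}
    {c : (Fin d → ℝ) → (Fin d → ℝ) → ℝ} {ε : ℝ} {φ : (Fin d → ℝ) → ℝ} {x : Fin d → ℝ}
    (hpos : 0 < ∫ y, Real.exp (φ y - c x y / ε) * ν y) :
    ∫ y, piJoint μ ν c ε φ (x, y) = μ x := by
  simp only [piJoint_mk]
  rw [integral_const_mul, phiPlus, Real.exp_log hpos]
  field_simp

lemma integrable_fst_mul_piJoint {μ ν : (Fin d → ℝ) → ℝ}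
    {c : (Fin d → ℝ) → (Fin d → ℝ) → ℝ} {ε : ℝ} {φ h : (Fin d → ℝ) → ℝ}
    (hμ0 : ∀ x, 0 ≤ μ x) (hν0 : ∀ y, 0 ≤ ν y) (hμm : Measurable μ) (hνm : Measurable ν)
    (hc : Measurable (Function.uncurry c)) (hφm : Measurable φ)
    (hpos : ∀ x, 0 < ∫ y, Real.exp (φ y - c x y / ε) * ν y)
    (hhm : Measurable h) (hh : Integrable (fun x => h x * μ x)) :
    Integrable (fun z : (Fin d → ℝ) × (Fin d → ℝ) => h z.1 * piJoint μ ν c ε φ z)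
      (volume.prod volume) := by
  have hπm := measurable_piJoint ε hμm hνm hc hφm
  rw [integrable_prod_iff (by fun_prop)]
  refine ⟨.of_forall fun x => (integrable_piJoint_right μ (hpos x)).const_mul (h x), ?_⟩
  refine hh.norm.congr (.of_forall fun x => ?_)
  simp only [norm_mul, Real.norm_of_nonneg (piJoint_nonneg c ε φ hμ0 hν0 _),
    integral_const_mul, integral_piJoint_right μ (hpos x), Real.norm_of_nonneg (hμ0 x)]

lemma integral_fst_mul_piJoint {μ ν : (Fin d → ℝ) → ℝ}
    {c : (Fin d → ℝ) → (Fin d → ℝ) → ℝ} {ε : ℝ} {φ h : (Fin d → ℝ) → ℝ}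
    (hμ0 : ∀ x, 0 ≤ μ x) (hν0 : ∀ y, 0 ≤ ν y) (hμm : Measurable μ) (hνm : Measurable ν)
    (hc : Measurable (Function.uncurry c)) (hφm : Measurable φ)
    (hpos : ∀ x, 0 < ∫ y, Real.exp (φ y - c x y / ε) * ν y)
    (hhm : Measurable h) (hh : Integrable (fun x => h x * μ x)) :
    ∫ z, h z.1 * piJoint μ ν c ε φ z ∂(volume.prod volume) = ∫ x, h x * μ x := by
  rw [integral_prod _ (integrable_fst_mul_piJoint hμ0 hν0 hμm hνm hc hφm hpos hhm hh)]
  simp only [integral_const_mul, fun x => integral_piJoint_right μ (hpos x)]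

lemma integrable_snd_mul_piJoint {μ ν : (Fin d → ℝ) → ℝ}
    {c : (Fin d → ℝ) → (Fin d → ℝ) → ℝ} {ε : ℝ} {φ g : (Fin d → ℝ) → ℝ}
    (hμ0 : ∀ x, 0 ≤ μ x) (hν0 : ∀ y, 0 ≤ ν y) (hgm : Measurable g)
    (hπ : Integrable (piJoint μ ν c ε φ) (volume.prod volume))
    (hg : Integrable (fun y => g y * piY μ ν c ε φ y)) :
    Integrable (fun z : (Fin d → ℝ) × (Fin d → ℝ) => g z.2 * piJoint μ ν c ε φ z)
      (volume.prod volume) := by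
  have hm : AEStronglyMeasurable
      (fun z : (Fin d → ℝ) × (Fin d → ℝ) => g z.2 * piJoint μ ν c ε φ z)
      (volume.prod volume) :=
    (hgm.comp measurable_snd).aestronglyMeasurable.mul hπ.aestronglyMeasurable
  rw [integrable_prod_iff' hm]
  refine ⟨hπ.prod_left_ae.mono fun y hy => hy.const_mul (g y), ?_⟩
  refine hg.norm.congr (.of_forall fun y => ?_)
  have hY : 0 ≤ piY μ ν c ε φ y :=
    integral_nonneg fun x => piJoint_nonneg c ε φ hμ0 hν0 (x, y)
  simp only [norm_mul, Real.norm_of_nonneg (piJoint_nonneg c ε φ hμ0 hν0 _),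
    integral_const_mul, Real.norm_of_nonneg hY]
  rfl

lemma integral_snd_mul_piJoint {μ ν : (Fin d → ℝ) → ℝ}
    {c : (Fin d → ℝ) → (Fin d → ℝ) → ℝ} {ε : ℝ} {φ g : (Fin d → ℝ) → ℝ}
    (hgπ : Integrable (fun z : (Fin d → ℝ) × (Fin d → ℝ) => g z.2 * piJoint μ ν c ε φ z)
      (volume.prod volume)) :
    ∫ z, g z.2 * piJoint μ ν c ε φ z ∂(volume.prod volume) =
      ∫ y, g y * piY μ ν c ε φ y := by
  rw [integral_prod_symm _ hgπ]
  simp only [integral_const_mul, piY]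

/-- The tangent-line inequality `t ≤ exp t - 1` between two joint densities. -/
lemma mul_piJoint_sub_le {μ ν : (Fin d → ℝ) → ℝ} (c : (Fin d → ℝ) → (Fin d → ℝ) → ℝ) (ε : ℝ)
    (φ φb : (Fin d → ℝ) → ℝ) (hμ0 : ∀ x, 0 ≤ μ x) (hν0 : ∀ y, 0 ≤ ν y)
    (z : (Fin d → ℝ) × (Fin d → ℝ)) :
    (φb z.2 - φ z.2) * piJoint μ ν c ε φ z -
        (phiPlus ν c ε φb z.1 - phiPlus ν c ε φ z.1) * piJoint μ ν c ε φ z ≤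
      1 * piJoint μ ν c ε φb z - 1 * piJoint μ ν c ε φ z := by
  have hπ := piJoint_nonneg c ε φ hμ0 hν0 z
  set t := (φb z.2 - φ z.2) - (phiPlus ν c ε φb z.1 - phiPlus ν c ε φ z.1) with ht
  have hexp : piJoint μ ν c ε φb z = Real.exp t * piJoint μ ν c ε φ z := by
    simp only [piJoint, ← mul_assoc, ← Real.exp_add]
    congr 3
    rw [ht]
    ring
  rw [hexp]
  nlinarith [mul_le_mul_of_nonneg_right (Real.add_one_le_exp t) hπ]

/-- Concavity of the semi-dual.
For all `φ, φ̄ ∈ L¹(ν)` with `J(φ)`, `J(φ̄)` finite, the Bregman gap is non-positive: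
`J(φ̄) − J(φ) − ⟨δJ(φ), φ̄ − φ⟩ ≤ 0`, where `⟨f,g⟩ = ∫ f g dy`. -/
theorem semiDual_concave
    (μ ν : (Fin d → ℝ) → ℝ) (c : (Fin d → ℝ) → (Fin d → ℝ) → ℝ) (ε : ℝ)
    (hε : 0 < ε) (hμ0 : ∀ x, 0 ≤ μ x) (hν0 : ∀ y, 0 ≤ ν y)
    (hμm : Measurable μ) (hνm : Measurable ν)
    (hμ1 : (∫ x, μ x) = 1) (hν1 : (∫ y, ν y) = 1)
    (hc : Measurable (Function.uncurry c))
    (φ φb : (Fin d → ℝ) → ℝ) (hφm : Measurable φ) (hφbm : Measurable φb)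
    (hφν : Integrable (fun y => φ y * ν y))
    (hφbν : Integrable (fun y => φb y * ν y))
    (hpos : ∀ x, 0 < ∫ y, Real.exp (φ y - c x y / ε) * ν y)
    (hposb : ∀ x, 0 < ∫ y, Real.exp (φb y - c x y / ε) * ν y)
    (hJ : Integrable (fun x => phiPlus ν c ε φ x * μ x))
    (hJb : Integrable (fun x => phiPlus ν c ε φb x * μ x))
    (hip : Integrable (fun y => deltaJ μ ν c ε φ y * (φb y - φ y))) :
    semiDual μ ν c ε φb - semiDual μ ν c ε φ -
      ∫ y, deltaJ μ ν c ε φ y * (φb y - φ y) ≤ 0 := by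
  have hμi : Integrable (fun x => (1 : ℝ) * μ x) := by
    simpa using Integrable.of_integral_ne_zero (f := μ) (by rw [hμ1]; exact one_ne_zero)
  have hpm := measurable_phiPlus ε hνm hc hφm
  have hpbm := measurable_phiPlus ε hνm hc hφbm
  have hπ := integrable_fst_mul_piJoint hμ0 hν0 hμm hνm hc hφm hpos
    (measurable_const (a := (1 : ℝ))) hμi
  have hπb := integrable_fst_mul_piJoint hμ0 hν0 hμm hνm hc hφbm hposb
    (measurable_const (a := (1 : ℝ))) hμi
  have hπe := integral_fst_mul_piJoint hμ0 hν0 hμm hνm hc hφm hpos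
    (measurable_const (a := (1 : ℝ))) hμi
  have hπbe := integral_fst_mul_piJoint hμ0 hν0 hμm hνm hc hφbm hposb
    (measurable_const (a := (1 : ℝ))) hμi
  have hD : Integrable (fun x => (phiPlus ν c ε φb x - phiPlus ν c ε φ x) * μ x) :=
    (hJb.sub hJ).congr (.of_forall fun x => (sub_mul _ _ _).symm)
  have hDπ := integrable_fst_mul_piJoint hμ0 hν0 hμm hνm hc hφm hpos (hpbm.sub hpm) hD
  have hDe := integral_fst_mul_piJoint hμ0 hν0 hμm hνm hc hφm hpos (hpbm.sub hpm) hD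
  have hY : (fun y => (φb y - φ y) * piY μ ν c ε φ y) = fun y =>
      φb y * ν y - φ y * ν y - deltaJ μ ν c ε φ y * (φb y - φ y) := by
    funext y
    simp only [deltaJ]
    ring
  have hYi : Integrable (fun y => (φb y - φ y) * piY μ ν c ε φ y) := by
    rw [hY]
    exact (hφbν.sub hφν).sub hip
  have hYe : ∫ y, (φb y - φ y) * piY μ ν c ε φ y = (∫ y, φb y * ν y) - (∫ y, φ y * ν y) -
      ∫ y, deltaJ μ ν c ε φ y * (φb y - φ y) := by
    rw [hY, ← integral_sub hφbν hφν]
    exact integral_sub (hφbν.sub hφν) hip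
  have hgπ := integrable_snd_mul_piJoint hμ0 hν0 (hφbm.sub hφm) (by simpa using hπ) hYi
  have hge := integral_snd_mul_piJoint hgπ
  have hDs : ∫ x, (phiPlus ν c ε φb x - phiPlus ν c ε φ x) * μ x =
      (∫ x, phiPlus ν c ε φb x * μ x) - ∫ x, phiPlus ν c ε φ x * μ x := by
    simp only [sub_mul]
    exact integral_sub hJb hJ
  have key := integral_mono (hgπ.sub hDπ) (hπb.sub hπ)
    (mul_piJoint_sub_le c ε φ φb hμ0 hν0)
  simp only [Pi.sub_apply] at hge hDe key hgπ hDπ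
  rw [integral_sub hgπ hDπ, integral_sub hπb hπ, hπe, hπbe, hge, hDe, hYe, hDs] at key
  simp only [semiDual]
  linarith
end
end

section
/- (Mirror-descent form of Φ-match) Let π^{ref}(x,y) := Z_{ref}^{-1} exp(−c(x,y)/ε) μ(x) ν(y) with Z_{ref} := ∬ exp(−c(x,y)/ε) dμ(x) dν(y) < ∞, and for a suitably integrable function h on 𝒳×𝒴 define δφ*(h)(x,y) := μ(x) · π^{ref}(x,y) e^{h(x,y)} / ∫_𝒴 π^{ref}(x,y') e^{h(x,y')} dy'. Let Φ be a map from nonnegative integrable functions on 𝒴 to positive bounded functions on 𝒴, let η ∈ [0,1], let φ⁰ ∈ L¹(ν), define φ^{n+1} := φ^n − η·(log Φ(π(φ^n,(φ^n)⁺)_𝒴) − log Φ(ν)), and write π^n := π(φ^n,(φ^n)⁺) and 𝒱_Φ(π^n)(x,y) := log Φ(π^n_𝒴)(y) − log Φ(ν)(y). Then for every n ≥ 0 the density identity π^{n+1} = δφ*( log(π^n/π^{ref}) − η·𝒱_Φ(π^n) ) holds. -/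
open MeasureTheory

noncomputable section

variable {d : ℕ}

/-- Kullback–Leibler divergence between two densities on `𝒳 × 𝒴`. -/
def klDiv2 (p q : ((Fin d → ℝ) × (Fin d → ℝ)) → ℝ) : ℝ :=
  ∫ z, p z * Real.log (p z / q z)

/-- `p` is a probability density on `𝒳 × 𝒴` (w.r.t. Lebesgue measure). -/
def IsProbDensity2 (p : ((Fin d → ℝ) × (Fin d → ℝ)) → ℝ) : Prop :=
  Measurable p ∧ (∀ z, 0 ≤ p z) ∧ (∫ z, p z) = 1

/-- `𝒳`-marginal density of a joint density. -/
def margX (p : ((Fin d → ℝ) × (Fin d → ℝ)) → ℝ) (x : Fin d → ℝ) : ℝ := ∫ y, p (x, y)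

/-- `𝒴`-marginal density of a joint density. -/
def margY (p : ((Fin d → ℝ) × (Fin d → ℝ)) → ℝ) (y : Fin d → ℝ) : ℝ := ∫ x, p (x, y)

/-- `p₀` is the unique (up to a.e. equality) minimizer of `F` over `S`. -/
def UniqueMinOn (F : (((Fin d → ℝ) × (Fin d → ℝ)) → ℝ) → ℝ)
    (S : Set (((Fin d → ℝ) × (Fin d → ℝ)) → ℝ))
    (p₀ : ((Fin d → ℝ) × (Fin d → ℝ)) → ℝ) : Prop :=
  p₀ ∈ S ∧ ∀ p ∈ S, F p₀ ≤ F p ∧ (F p = F p₀ → p =ᵐ[volume] p₀)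

/-- Normalising constant `Z = ∫ (Φ(ν)/Φ(π_𝒴)) π_𝒴 dy`. -/
def Zconst (ν : (Fin d → ℝ) → ℝ) (Φ : ((Fin d → ℝ) → ℝ) → ((Fin d → ℝ) → ℝ))
    (p : ((Fin d → ℝ) × (Fin d → ℝ)) → ℝ) : ℝ :=
  ∫ y, Φ ν y / Φ (margY p) y * margY p y

/-- The reweighted joint density `Z⁻¹ · π · Φ(ν)/Φ(π_𝒴)`. -/
def piHalf (ν : (Fin d → ℝ) → ℝ) (Φ : ((Fin d → ℝ) → ℝ) → ((Fin d → ℝ) → ℝ))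
    (p : ((Fin d → ℝ) × (Fin d → ℝ)) → ℝ) (z : (Fin d → ℝ) × (Fin d → ℝ)) : ℝ :=
  (Zconst ν Φ p)⁻¹ * (p z * (Φ ν z.2 / Φ (margY p) z.2))

/-- `𝒱_Φ(π)(x,y) = log Φ(π_𝒴)(y) − log Φ(ν)(y)`. -/
def Vphi (ν : (Fin d → ℝ) → ℝ) (Φ : ((Fin d → ℝ) → ℝ) → ((Fin d → ℝ) → ℝ))
    (p : ((Fin d → ℝ) × (Fin d → ℝ)) → ℝ) (z : (Fin d → ℝ) × (Fin d → ℝ)) : ℝ :=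
  Real.log (Φ (margY p) z.2) - Real.log (Φ ν z.2)

/-- The reference density `π^{ref}(x,y) = Z_ref⁻¹ exp(−c(x,y)/ε) μ(x) ν(y)`. -/
def piRef (μ ν : (Fin d → ℝ) → ℝ) (c : (Fin d → ℝ) → (Fin d → ℝ) → ℝ) (ε : ℝ)
    (z : (Fin d → ℝ) × (Fin d → ℝ)) : ℝ :=
  (∫ w : (Fin d → ℝ) × (Fin d → ℝ), Real.exp (-c w.1 w.2 / ε) * μ w.1 * ν w.2)⁻¹ *
    (Real.exp (-c z.1 z.2 / ε) * μ z.1 * ν z.2)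

/-- The mirror map `δφ*(h)(x,y) = μ(x) π^{ref}(x,y) e^{h(x,y)} / ∫ π^{ref}(x,y') e^{h(x,y')} dy'`. -/
def deltaPhiStar (μ ν : (Fin d → ℝ) → ℝ) (c : (Fin d → ℝ) → (Fin d → ℝ) → ℝ) (ε : ℝ)
    (h : ((Fin d → ℝ) × (Fin d → ℝ)) → ℝ) (z : (Fin d → ℝ) × (Fin d → ℝ)) : ℝ :=
  μ z.1 * (piRef μ ν c ε z * Real.exp (h z)) /
    ∫ y', piRef μ ν c ε (z.1, y') * Real.exp (h (z.1, y'))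

/-- Where `φ⁺` is defined, `e^{φ⁺}` is its integral. -/
theorem exp_phiPlus {ν : (Fin d → ℝ) → ℝ} {c : (Fin d → ℝ) → (Fin d → ℝ) → ℝ} {ε : ℝ}
    {φ : (Fin d → ℝ) → ℝ} {x : Fin d → ℝ}
    (hpos : 0 < ∫ y, Real.exp (φ y - c x y / ε) * ν y) :
    Real.exp (phiPlus ν c ε φ x) = ∫ y, Real.exp (φ y - c x y / ε) * ν y :=
  Real.exp_log hpos

/-- Tilting the joint density by `e^{-g(y)}` amounts to shifting the potential by `-g`, with the
normalisation `φ⁺` unchanged. -/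
theorem piJoint_mul_exp_neg (μ ν : (Fin d → ℝ) → ℝ) (c : (Fin d → ℝ) → (Fin d → ℝ) → ℝ) (ε : ℝ)
    (φ g : (Fin d → ℝ) → ℝ) (z : (Fin d → ℝ) × (Fin d → ℝ)) :
    piJoint μ ν c ε φ z * Real.exp (-g z.2) =
      μ z.1 * Real.exp (-phiPlus ν c ε φ z.1) *
        (Real.exp ((φ z.2 - g z.2) - c z.1 z.2 / ε) * ν z.2) := by
  have h : Real.exp (φ z.2 - phiPlus ν c ε φ z.1 - c z.1 z.2 / ε) * Real.exp (-g z.2) =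
      Real.exp (-phiPlus ν c ε φ z.1) * Real.exp ((φ z.2 - g z.2) - c z.1 z.2 / ε) := by
    rw [← Real.exp_add, ← Real.exp_add]
    congr 1
    ring
  unfold piJoint
  linear_combination μ z.1 * ν z.2 * h

/-- The mirror map applied to `log(π(φ,φ⁺)/π^{ref}) - g(y)` is `π(φ - g, (φ - g)⁺)`. -/
theorem deltaPhiStar_log_div_piRef_sub {μ ν : (Fin d → ℝ) → ℝ}
    {c : (Fin d → ℝ) → (Fin d → ℝ) → ℝ} {ε : ℝ} (hμ0 : ∀ x, 0 < μ x) (hν0 : ∀ y, 0 < ν y)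
    (hZrefpos : 0 < ∫ w : (Fin d → ℝ) × (Fin d → ℝ),
      Real.exp (-c w.1 w.2 / ε) * μ w.1 * ν w.2)
    (φ g : (Fin d → ℝ) → ℝ) (z : (Fin d → ℝ) × (Fin d → ℝ))
    (hpos : 0 < ∫ y, Real.exp ((φ y - g y) - c z.1 y / ε) * ν y) :
    deltaPhiStar μ ν c ε
        (fun w => Real.log (piJoint μ ν c ε φ w / piRef μ ν c ε w) - g w.2) z =
      piJoint μ ν c ε (fun y => φ y - g y) z := by
  have href : ∀ w, 0 < piRef μ ν c ε w := fun w =>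
    mul_pos (inv_pos.mpr hZrefpos)
      (mul_pos (mul_pos (Real.exp_pos _) (hμ0 _)) (hν0 _))
  have hjoint : ∀ w, 0 < piJoint μ ν c ε φ w := fun w =>
    mul_pos (mul_pos (Real.exp_pos _) (hμ0 _)) (hν0 _)
  have htilt : ∀ w, piRef μ ν c ε w *
      Real.exp (Real.log (piJoint μ ν c ε φ w / piRef μ ν c ε w) - g w.2) =
      μ w.1 * Real.exp (-phiPlus ν c ε φ w.1) *
        (Real.exp ((φ w.2 - g w.2) - c w.1 w.2 / ε) * ν w.2) := fun w => by
    rw [sub_eq_add_neg, Real.exp_add, Real.exp_log (div_pos (hjoint w) (href w)), ← mul_assoc,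
      mul_div_cancel₀ _ (href w).ne', piJoint_mul_exp_neg]
  have hμ := (hμ0 z.1).ne'
  have hexp := (Real.exp_pos (-phiPlus ν c ε φ z.1)).ne'
  have hint := hpos.ne'
  simp only [deltaPhiStar, htilt]
  rw [integral_const_mul]
  unfold piJoint
  rw [sub_right_comm _ (phiPlus _ _ _ _ _), Real.exp_sub _ (phiPlus _ _ _ _ _),
    exp_phiPlus (φ := fun y => φ y - g y) hpos]
  field_simp

/-- Mirror-descent form of Φ-match.
For every `n`, `π^{n+1} = δφ*( log(π^n/π^{ref}) − η·𝒱_Φ(π^n) )`. -/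
theorem phiMatch_mirror_descent_form
    (μ ν : (Fin d → ℝ) → ℝ) (c : (Fin d → ℝ) → (Fin d → ℝ) → ℝ) (ε : ℝ)
    (hε : 0 < ε) (hμ0 : ∀ x, 0 < μ x) (hν0 : ∀ y, 0 < ν y)
    (hμm : Measurable μ) (hνm : Measurable ν)
    (hμ1 : (∫ x, μ x) = 1) (hν1 : (∫ y, ν y) = 1)
    (hc : Measurable (Function.uncurry c))
    (hZref : Integrable
      (fun w : (Fin d → ℝ) × (Fin d → ℝ) => Real.exp (-c w.1 w.2 / ε) * μ w.1 * ν w.2))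
    (hZrefpos : 0 < ∫ w : (Fin d → ℝ) × (Fin d → ℝ),
      Real.exp (-c w.1 w.2 / ε) * μ w.1 * ν w.2)
    (Φ : ((Fin d → ℝ) → ℝ) → ((Fin d → ℝ) → ℝ))
    (hΦpos : ∀ f : (Fin d → ℝ) → ℝ, ∀ y, 0 < Φ f y)
    (hΦbdd : ∀ f : (Fin d → ℝ) → ℝ, ∃ M, ∀ y, Φ f y ≤ M)
    (η : ℝ) (hη : η ∈ Set.Icc (0 : ℝ) 1)
    (φ : ℕ → (Fin d → ℝ) → ℝ)
    (hφ0 : Integrable (fun y => φ 0 y * ν y))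
    (hrec : ∀ n, φ (n + 1) = fun y =>
      φ n y - η * (Real.log (Φ (piY μ ν c ε (φ n)) y) - Real.log (Φ ν y)))
    (hinner : ∀ n x, Integrable (fun y => Real.exp (φ n y - c x y / ε) * ν y))
    (hpos : ∀ n x, 0 < ∫ y, Real.exp (φ n y - c x y / ε) * ν y) :
    ∀ (n : ℕ) (z : (Fin d → ℝ) × (Fin d → ℝ)),
      piJoint μ ν c ε (φ (n + 1)) z =
        deltaPhiStar μ ν c ε
          (fun w => Real.log (piJoint μ ν c ε (φ n) w / piRef μ ν c ε w) -
            η * Vphi ν Φ (piJoint μ ν c ε (φ n)) w) z := by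
  intro n z
  have hpos' := hpos (n + 1) z.1
  rw [hrec n] at hpos' ⊢
  exact (deltaPhiStar_log_div_piRef_sub hμ0 hν0 hZrefpos (φ n) _ z hpos').symm
end
end

section
/- (Convergence rate of projected semi-dual gradient ascent) Assume c(x,y) ≥ 0 for all (x,y), let B > 0 with λ(B) := e^{2B} · E_{(x,y')∼μ⊗ν}[exp(c(x,y')/ε)] < ∞, and set S_B := { φ ∈ L²(ν) : ‖φ‖_{L^∞(𝒴)} ≤ B }. For φ ∈ S_B and η > 0 let M(φ; η) be the minimizer over φ̄ ∈ S_B of ‖ φ̄ − (φ + η · δJ(φ)/ν) ‖²_{L²(ν)}, where (δJ(φ)/ν)(y) := δJ(φ)(y)/ν(y). Let φ⁰ ∈ S_B, define φ^{n+1} := M(φ^n; λ(B)^{-1}), and suppose φ̃* is a maximizer of J over S_B. Then for every N ≥ 1, φ^N ∈ S_B and J(φ^N) − J(φ̃*) ≥ − λ(B) · ‖φ⁰ − φ̃*‖²_{L²(ν)} / (2N). -/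
open MeasureTheory

noncomputable section

variable {d : ℕ}

/-- `λ(B) = e^{2B} · E_{(x,y')∼μ⊗ν}[exp(c(x,y')/ε)]`. -/
def lamB (μ ν : (Fin d → ℝ) → ℝ) (c : (Fin d → ℝ) → (Fin d → ℝ) → ℝ) (ε B : ℝ) : ℝ :=
  Real.exp (2 * B) *
    ∫ z : (Fin d → ℝ) × (Fin d → ℝ), Real.exp (c z.1 z.2 / ε) * μ z.1 * ν z.2

/-- Variational inequality for a minimizer of the `L²` distance over a convex set. -/
lemma integral_sub_mul_sub_nonneg_of_forall_le {β : Type*} [MeasurableSpace β] {N : Measure β}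
    {S : Set (β → ℝ)} (hS : Convex ℝ S)
    {f P χ : β → ℝ} (hPf : MemLp (fun y => P y - f y) 2 N) (hχP : MemLp (fun y => χ y - P y) 2 N)
    (hP : P ∈ S) (hχ : χ ∈ S)
    (hmin : ∀ ξ ∈ S, ∫ y, (P y - f y) ^ 2 ∂N ≤ ∫ y, (ξ y - f y) ^ 2 ∂N) :
    0 ≤ ∫ y, (P y - f y) * (χ y - P y) ∂N := by
  set I := ∫ y, (P y - f y) * (χ y - P y) ∂N with hI
  set A := ∫ y, (χ y - P y) ^ 2 ∂N with hA
  have hquad : ∀ t ∈ Set.Ioc (0 : ℝ) 1, 0 ≤ 2 * I + t * A := by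
    intro t ht
    have hmem : (fun y => P y + t * (χ y - P y)) ∈ S := by
      have := hS hP hχ (a := 1 - t) (b := t) (by linarith [ht.2]) ht.1.le (by ring)
      convert this using 1
      ext y; simp; ring
    have h := hmin _ hmem
    have hexp : ∫ y, (P y + t * (χ y - P y) - f y) ^ 2 ∂N
        = ∫ y, (P y - f y) ^ 2 ∂N + (2 * t * I + t ^ 2 * A) := by
      have hprod : Integrable (fun y => (P y - f y) * (χ y - P y)) N := hPf.integrable_mul hχP
      have hsum : Integrable (fun y => 2 * t * ((P y - f y) * (χ y - P y))
          + t ^ 2 * (χ y - P y) ^ 2) N :=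
        (hprod.const_mul _).add (hχP.integrable_sq.const_mul _)
      rw [hI, hA, ← integral_const_mul, ← integral_const_mul,
        ← integral_add (hprod.const_mul _) (hχP.integrable_sq.const_mul _),
        ← integral_add hPf.integrable_sq hsum]
      exact integral_congr_ae (Filter.Eventually.of_forall fun y => by ring)
    rw [hexp] at h
    have h2 : 0 ≤ t * (2 * I + t * A) := by nlinarith
    exact nonneg_of_mul_nonneg_right h2 ht.1
  have hlim : Filter.Tendsto (fun t : ℝ => 2 * I + t * A) (nhdsWithin 0 (Set.Ioi 0))
      (nhds (2 * I + 0 * A)) :=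
    (Continuous.tendsto (by fun_prop) 0).mono_left nhdsWithin_le_nhds
  have := ge_of_tendsto hlim
    (Filter.eventually_of_mem (Ioc_mem_nhdsGT one_pos) hquad)
  linarith

section SingleMeasure

variable {β : Type*} [MeasurableSpace β] {N : Measure β} [IsProbabilityMeasure N]

open ProbabilityTheory in
/-- Second-order Taylor expansion of the log-partition function `f ↦ log ∫ exp f` along a bounded
direction. -/
lemma exists_log_integral_exp_add_eq {f h : β → ℝ} (hf : Integrable (fun y => Real.exp (f y)) N)
    (hh : Measurable h) {C : ℝ} (hC : ∀ᵐ y ∂N, |h y| ≤ C) :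
    ∃ u ∈ Set.Ioo (0 : ℝ) 1, Real.log (∫ y, Real.exp (f y + h y) ∂N) =
      Real.log (∫ y, Real.exp (f y) ∂N) + (∫ y, h y ∂N.tilted f)
        + Var[h; N.tilted (f + fun y => u * h y)] / 2 := by
  set P := N.tilted f with hP
  have : IsProbabilityMeasure P := isProbabilityMeasure_tilted hf
  have hCP : ∀ᵐ y ∂P, |h y| ≤ C := (tilted_absolutelyContinuous N f) hC
  set a := ∫ y, h y ∂P with ha
  have hhint : Integrable h P :=
    Integrable.of_bound hh.aestronglyMeasurable C (by simpa using hCP)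
  have hexp : ∀ t : ℝ, Integrable (fun y => Real.exp (t * (h y - a))) P := fun t =>
    integrable_exp_mul_of_mem_Icc (a := -C - a) (b := C - a) (by fun_prop) (by
      filter_upwards [hCP] with y hy
      rw [abs_le] at hy
      constructor <;> linarith [hy.1, hy.2])
  have hexp' : ∀ t : ℝ, Integrable (fun y => Real.exp (t * h y)) P := fun t =>
    integrable_exp_mul_of_mem_Icc (a := -C) (b := C) (by fun_prop) (by
      filter_upwards [hCP] with y hy
      exact abs_le.1 hy)
  have huniv : integrableExpSet (fun y => h y - a) P = Set.univ := by
    ext t; simpa [integrableExpSet] using hexp t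
  obtain ⟨u, hu, hcgf⟩ := exists_cgf_eq_iteratedDeriv_two_cgf_mul (μ := P)
    (X := fun y => h y - a) (t := 1) one_pos
    (by rw [integral_sub hhint (integrable_const a)]; simp [ha])
    (by simp [huniv])
  refine ⟨u, hu, ?_⟩
  have hZ : 0 < ∫ y, Real.exp (f y) ∂N := integral_exp_pos hf
  have hfu : Integrable (fun y => Real.exp ((f + fun y => u * h y) y)) N := by
    have := (integrable_tilted_iff hf (fun y => Real.exp (u * h y))).1 (hexp' u)
    simpa [Real.exp_add] using this
  have : IsProbabilityMeasure (N.tilted (f + fun y => u * h y)) := isProbabilityMeasure_tilted hfu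
  have hshift : P.tilted (fun y => u * (h y - a)) = N.tilted (f + fun y => u * h y) := by
    rw [hP, tilted_tilted hf, ← tilted_const (N.tilted (f + fun y => u * h y)) (-(u * a)),
      tilted_tilted hfu]
    congr 1
    ext y
    simp only [Pi.add_apply]
    ring
  rw [← variance_tilted_mul (by simp [huniv]), hshift,
    variance_sub_const hh.aestronglyMeasurable] at hcgf
  have hlog : cgf (fun y => h y - a) P 1 = Real.log (∫ y, Real.exp (f y + h y) ∂N)
      - Real.log (∫ y, Real.exp (f y) ∂N) - a := by
    have hint : 0 < ∫ y, Real.exp (h y) ∂P := integral_exp_pos (by simpa using hexp' 1)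
    have : ∫ y, Real.exp (h y) ∂P
        = (∫ y, Real.exp (f y + h y) ∂N) / ∫ y, Real.exp (f y) ∂N := by
      rw [hP, integral_exp_tilted]; rfl
    have hpos : (∫ y, Real.exp (f y + h y) ∂N) ≠ 0 := by
      rintro h0
      rw [this, h0] at hint
      simp at hint
    simp only [cgf, mgf, one_mul, Real.exp_sub, integral_div]
    rw [Real.log_div hint.ne' (Real.exp_ne_zero a), Real.log_exp, this, Real.log_div hpos hZ.ne']
  rw [hlog] at hcgf
  linarith

/-- The normalizing constant of a bounded potential is bounded below by the reciprocal of
`exp B * ∫ exp k`. -/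
lemma exp_neg_div_le_integral_exp_sub {φ k : β → ℝ} {B : ℝ} (hφ : Measurable φ)
    (hφB : ∀ᵐ y ∂N, |φ y| ≤ B) (hk : Measurable k) (hk0 : ∀ y, 0 ≤ k y)
    (hkint : Integrable (fun y => Real.exp (k y)) N) :
    Integrable (fun y => Real.exp (φ y - k y)) N ∧
      Real.exp (-B) / (∫ y, Real.exp (k y) ∂N) ≤ ∫ y, Real.exp (φ y - k y) ∂N ∧
      ∫ y, Real.exp (φ y - k y) ∂N ≤ Real.exp B := by
  have hbd : ∀ᵐ y ∂N, Real.exp (φ y - k y) ≤ Real.exp B := by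
    filter_upwards [hφB] with y hy
    exact Real.exp_le_exp.2 (by linarith [(abs_le.1 hy).2, hk0 y])
  have hint : Integrable (fun y => Real.exp (φ y - k y)) N :=
    Integrable.of_bound (by fun_prop) (Real.exp B) (by
      simpa [Real.norm_eq_abs, abs_of_pos (Real.exp_pos _)] using hbd)
  refine ⟨hint, ?_, by simpa using integral_mono_ae hint (integrable_const _) hbd⟩
  set K := ∫ y, Real.exp (k y) ∂N with hK
  have hKpos : 0 < K := integral_exp_pos hkint
  have hlow : ∀ᵐ y ∂N, Real.exp (-B) * (2 * K⁻¹ - K⁻¹ ^ 2 * Real.exp (k y))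
      ≤ Real.exp (φ y - k y) := by
    filter_upwards [hφB] with y hy
    have h1 : 2 * K⁻¹ - K⁻¹ ^ 2 * Real.exp (k y) ≤ Real.exp (-k y) := by
      have hp := Real.exp_pos (k y)
      have h2 : Real.exp (-k y) * Real.exp (k y) = 1 := by rw [← Real.exp_add]; simp
      have h3 : 0 ≤ Real.exp (-k y) * (1 - K⁻¹ * Real.exp (k y)) ^ 2 := by positivity
      have h4 : Real.exp (-k y) * (1 - K⁻¹ * Real.exp (k y)) ^ 2 =
          Real.exp (-k y) - 2 * K⁻¹ * (Real.exp (-k y) * Real.exp (k y))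
            + K⁻¹ ^ 2 * Real.exp (k y) * (Real.exp (-k y) * Real.exp (k y)) := by ring
      rw [h4, h2] at h3
      linarith
    calc _ ≤ Real.exp (-B) * Real.exp (-k y) := by gcongr
      _ = Real.exp (-B - k y) := by rw [← Real.exp_add]; ring_nf
      _ ≤ _ := Real.exp_le_exp.2 (by linarith [(abs_le.1 hy).1])
  have hi : Integrable (fun y => Real.exp (-B) * (2 * K⁻¹ - K⁻¹ ^ 2 * Real.exp (k y))) N :=
    ((integrable_const _).sub (hkint.const_mul _)).const_mul _
  have := integral_mono_ae hi hint hlow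
  rw [integral_const_mul, integral_sub (integrable_const _) (hkint.const_mul _),
    integral_const_mul, integral_const_mul, ← hK] at this
  simp only [integral_const, probReal_univ, smul_eq_mul, one_mul] at this
  have h5 : 2 * K⁻¹ - K⁻¹ ^ 2 * K = K⁻¹ := by field_simp; ring
  rwa [h5, ← div_eq_mul_inv] at this

/-- Gibbs densities of bounded potentials are bounded by `exp (2 * B) * ∫ exp k`. -/
lemma exp_sub_log_integral_le {φ k : β → ℝ} {B : ℝ} (hφ : Measurable φ)
    (hφB : ∀ᵐ y ∂N, |φ y| ≤ B) (hk : Measurable k) (hk0 : ∀ y, 0 ≤ k y)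
    (hkint : Integrable (fun y => Real.exp (k y)) N) {y : β} (hy : |φ y| ≤ B) :
    Real.exp (φ y - k y) / (∫ y, Real.exp (φ y - k y) ∂N)
      ≤ Real.exp (2 * B) * ∫ y, Real.exp (k y) ∂N := by
  obtain ⟨hint, hlow, -⟩ := exp_neg_div_le_integral_exp_sub hφ hφB hk hk0 hkint
  have hKpos : 0 < ∫ y, Real.exp (k y) ∂N := integral_exp_pos hkint
  rw [div_le_iff₀ (integral_exp_pos hint)]
  calc Real.exp (φ y - k y) ≤ Real.exp B :=
        Real.exp_le_exp.2 (by linarith [(abs_le.1 hy).2, hk0 y])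
    _ = Real.exp (2 * B) * (∫ y, Real.exp (k y) ∂N)
        * (Real.exp (-B) / ∫ y, Real.exp (k y) ∂N) := by
        field_simp
        rw [← Real.exp_add]; ring_nf
    _ ≤ _ := by gcongr

open ProbabilityTheory in
/-- The log-partition function is convex and smooth along bounded potentials. -/
lemma log_integral_exp_bounds {φ ψ k : β → ℝ} {B : ℝ} (hφ : Measurable φ)
    (hφB : ∀ᵐ y ∂N, |φ y| ≤ B) (hψ : Measurable ψ) (hψB : ∀ᵐ y ∂N, |ψ y| ≤ B)
    (hk : Measurable k) (hk0 : ∀ y, 0 ≤ k y)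
    (hkint : Integrable (fun y => Real.exp (k y)) N) :
    Real.log (∫ y, Real.exp (φ y - k y) ∂N)
        + ∫ y, (ψ y - φ y) * (Real.exp (φ y - Real.log (∫ y, Real.exp (φ y - k y) ∂N) - k y)) ∂N
      ≤ Real.log (∫ y, Real.exp (ψ y - k y) ∂N) ∧
    Real.log (∫ y, Real.exp (ψ y - k y) ∂N) ≤ Real.log (∫ y, Real.exp (φ y - k y) ∂N)
        + ∫ y, (ψ y - φ y) * (Real.exp (φ y - Real.log (∫ y, Real.exp (φ y - k y) ∂N) - k y)) ∂N
        + Real.exp (2 * B) * (∫ y, Real.exp (k y) ∂N) * (∫ y, (ψ y - φ y) ^ 2 ∂N) / 2 := by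
  obtain ⟨hint, -, -⟩ := exp_neg_div_le_integral_exp_sub hφ hφB hk hk0 hkint
  have hZ := integral_exp_pos hint
  have hdiff : ∀ᵐ y ∂N, |ψ y - φ y| ≤ 2 * B := by
    filter_upwards [hφB, hψB] with y h1 h2
    rw [abs_le] at *
    constructor <;> linarith [h1.1, h1.2, h2.1, h2.2]
  obtain ⟨u, hu, hexpand⟩ := exists_log_integral_exp_add_eq hint (hψ.sub hφ) hdiff
  have hlin : ∫ y, (ψ y - φ y) *
      (Real.exp (φ y - Real.log (∫ y, Real.exp (φ y - k y) ∂N) - k y)) ∂N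
      = ∫ y, (ψ - φ) y ∂N.tilted (fun y => φ y - k y) := by
    rw [integral_tilted]
    refine integral_congr_ae (Filter.Eventually.of_forall fun y => ?_)
    simp only [Pi.sub_apply, smul_eq_mul]
    rw [mul_comm, sub_right_comm, Real.exp_sub (φ y - k y), Real.exp_log hZ]
  have hsum : ∫ y, Real.exp (φ y - k y + (ψ - φ) y) ∂N = ∫ y, Real.exp (ψ y - k y) ∂N := by
    refine integral_congr_ae (Filter.Eventually.of_forall fun y => ?_)
    simp only [Pi.sub_apply]
    ring_nf
  rw [hsum, ← hlin] at hexpand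
  set χ : β → ℝ := fun y => φ y + u * (ψ y - φ y) with hχ
  have hχm : Measurable χ := by fun_prop
  have hχB : ∀ᵐ y ∂N, |χ y| ≤ B := by
    filter_upwards [hφB, hψB] with y h1 h2
    rw [abs_le] at *
    simp only [hχ]
    constructor <;> nlinarith [h1.1, h1.2, h2.1, h2.2, hu.1, hu.2]
  have hχeq : ((fun y => φ y - k y) + fun y => u * (ψ - φ) y) = fun y => χ y - k y := by
    ext y; simp [hχ]; ring
  rw [hχeq] at hexpand
  have hχint := (exp_neg_div_le_integral_exp_sub hχm hχB hk hk0 hkint).1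
  have hprob : IsProbabilityMeasure (N.tilted fun y => χ y - k y) :=
    isProbabilityMeasure_tilted hχint
  have hvar0 := variance_nonneg (ψ - φ) (N.tilted fun y => χ y - k y)
  have hvar : Var[ψ - φ; N.tilted fun y => χ y - k y]
      ≤ Real.exp (2 * B) * (∫ y, Real.exp (k y) ∂N) * ∫ y, (ψ y - φ y) ^ 2 ∂N := by
    refine (variance_le_expectation_sq (by fun_prop)).trans ?_
    rw [integral_tilted, ← integral_const_mul]
    refine integral_mono_of_nonneg (Filter.Eventually.of_forall fun y => ?_) ?_ ?_
    · simp only [Pi.zero_apply, smul_eq_mul]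
      exact mul_nonneg (div_nonneg (Real.exp_pos _).le (integral_exp_pos hχint).le) (sq_nonneg _)
    · refine Integrable.const_mul (Integrable.of_bound (by fun_prop) ((2 * B) ^ 2) ?_) _
      filter_upwards [hdiff] with y hy
      rw [Real.norm_eq_abs, abs_pow]
      gcongr
    · filter_upwards [hχB] with y hy
      simp only [smul_eq_mul, Pi.pow_apply, Pi.sub_apply]
      exact mul_le_mul_of_nonneg_right (exp_sub_log_integral_le hχm hχB hk hk0 hkint hy)
        (sq_nonneg _)
  constructor <;> linarith

end SingleMeasure

section ProductMeasure

variable {α β : Type*} [MeasurableSpace α] [MeasurableSpace β]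

/-- The log-partition function `x ↦ log ∫ exp (φ y - k x y) ∂N y`. -/
def logPartition (N : Measure β) (k : α → β → ℝ) (φ : β → ℝ) (x : α) : ℝ :=
  Real.log (∫ y, Real.exp (φ y - k x y) ∂N)

/-- The semi-dual functional with respect to general reference measures. -/
def dualValue (m : Measure α) (N : Measure β) (k : α → β → ℝ) (φ : β → ℝ) : ℝ :=
  (∫ y, φ y ∂N) - ∫ x, logPartition N k φ x ∂m

/-- The density with respect to `N` of the second marginal of the Gibbs coupling. -/
def gibbsMarginal (m : Measure α) (N : Measure β) (k : α → β → ℝ) (φ : β → ℝ) (y : β) : ℝ :=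
  ∫ x, Real.exp (φ y - logPartition N k φ x - k x y) ∂m

lemma gibbsMarginal_nonneg {m : Measure α} {N : Measure β} {k : α → β → ℝ} {φ : β → ℝ} (y : β) :
    0 ≤ gibbsMarginal m N k φ y :=
  integral_nonneg fun _ => (Real.exp_pos _).le

variable {m : Measure α} {N : Measure β} [IsProbabilityMeasure m] [IsProbabilityMeasure N]
  {k : α → β → ℝ} {φ ψ : β → ℝ} {B : ℝ}

lemma measurable_logPartition (hk : Measurable (Function.uncurry k)) (hφ : Measurable φ) :
    Measurable (logPartition N k φ) := by
  refine Real.measurable_log.comp (StronglyMeasurable.integral_prod_right' (ν := N)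
    (f := fun z : α × β => Real.exp (φ z.2 - k z.1 z.2)) ?_).measurable
  exact (Real.measurable_exp.comp ((hφ.comp measurable_snd).sub hk)).stronglyMeasurable

lemma integrable_logPartition (hk : Measurable (Function.uncurry k)) (hk0 : ∀ x y, 0 ≤ k x y)
    (hkint : Integrable (fun z : α × β => Real.exp (k z.1 z.2)) (m.prod N))
    (hφ : Measurable φ) (hφB : ∀ᵐ y ∂N, |φ y| ≤ B) :
    Integrable (logPartition N k φ) m := by
  refine Integrable.mono' (hkint.integral_prod_left.add (integrable_const |B|))
    (measurable_logPartition hk hφ).aestronglyMeasurable ?_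
  filter_upwards [hkint.prod_right_ae] with x hx
  obtain ⟨hi, hlow, hup⟩ := exp_neg_div_le_integral_exp_sub hφ hφB hk.of_uncurry_left (hk0 x) hx
  have hZ := integral_exp_pos hi
  have hK : 0 < ∫ y, Real.exp (k x y) ∂N := integral_exp_pos hx
  have h1 : logPartition N k φ x ≤ B := (Real.log_le_iff_le_exp hZ).2 hup
  have h2 := Real.log_le_log (by positivity) hlow
  rw [Real.log_div (Real.exp_ne_zero _) hK.ne', Real.log_exp] at h2
  have h3 := Real.log_le_self hK.le
  have h4 := le_abs_self B
  rw [Real.norm_eq_abs, abs_le]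
  simp only [Pi.add_apply]
  constructor
  · change _ ≤ Real.log _
    linarith
  · linarith

lemma exp_sub_logPartition_le (hk : Measurable (Function.uncurry k)) (hk0 : ∀ x y, 0 ≤ k x y)
    (hφ : Measurable φ) (hφB : ∀ᵐ y ∂N, |φ y| ≤ B) {x : α}
    (hx : Integrable (fun y => Real.exp (k x y)) N) {y : β} (hy : |φ y| ≤ B) :
    Real.exp (φ y - logPartition N k φ x - k x y)
      ≤ Real.exp (2 * B) * ∫ y, Real.exp (k x y) ∂N := by
  have hZ := integral_exp_pos
    (exp_neg_div_le_integral_exp_sub hφ hφB hk.of_uncurry_left (hk0 x) hx).1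
  rw [sub_right_comm, Real.exp_sub, logPartition, Real.exp_log hZ]
  exact exp_sub_log_integral_le hφ hφB hk.of_uncurry_left (hk0 x) hx hy

lemma measurable_gibbs (hk : Measurable (Function.uncurry k)) (hφ : Measurable φ) :
    Measurable fun z : α × β => Real.exp (φ z.2 - logPartition N k φ z.1 - k z.1 z.2) :=
  Real.measurable_exp.comp (((hφ.comp measurable_snd).sub
    ((measurable_logPartition hk hφ).comp measurable_fst)).sub hk)

lemma measurable_gibbsMarginal (hk : Measurable (Function.uncurry k)) (hφ : Measurable φ) :
    Measurable (gibbsMarginal m N k φ) :=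
  (StronglyMeasurable.integral_prod_left' (μ := m)
    (f := fun z : α × β => Real.exp (φ z.2 - logPartition N k φ z.1 - k z.1 z.2))
    (measurable_gibbs hk hφ).stronglyMeasurable).measurable

lemma gibbsMarginal_le (hk : Measurable (Function.uncurry k)) (hk0 : ∀ x y, 0 ≤ k x y)
    (hkint : Integrable (fun z : α × β => Real.exp (k z.1 z.2)) (m.prod N))
    (hφ : Measurable φ) (hφB : ∀ᵐ y ∂N, |φ y| ≤ B) {y : β} (hy : |φ y| ≤ B) :
    gibbsMarginal m N k φ y
      ≤ Real.exp (2 * B) * ∫ z : α × β, Real.exp (k z.1 z.2) ∂(m.prod N) := by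
  rw [integral_prod _ hkint, ← integral_const_mul]
  refine integral_mono_of_nonneg (Filter.Eventually.of_forall fun _ => (Real.exp_pos _).le)
    (hkint.integral_prod_left.const_mul _) ?_
  filter_upwards [hkint.prod_right_ae] with x hx
  exact exp_sub_logPartition_le hk hk0 hφ hφB hx hy

lemma integrable_mul_gibbs (hk : Measurable (Function.uncurry k)) (hk0 : ∀ x y, 0 ≤ k x y)
    (hkint : Integrable (fun z : α × β => Real.exp (k z.1 z.2)) (m.prod N))
    (hφ : Measurable φ) (hφB : ∀ᵐ y ∂N, |φ y| ≤ B) {w : β → ℝ} (hw : Measurable w) {C : ℝ}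
    (hwC : ∀ᵐ y ∂N, |w y| ≤ C) :
    Integrable (fun z : α × β =>
      w z.2 * Real.exp (φ z.2 - logPartition N k φ z.1 - k z.1 z.2)) (m.prod N) := by
  have hdom : Integrable (fun z : α × β =>
      C * (Real.exp (2 * B) * ∫ y, Real.exp (k z.1 y) ∂N)) (m.prod N) :=
    ((hkint.integral_prod_left.comp_fst N).const_mul _).const_mul _
  refine Integrable.mono' hdom
    ((hw.comp measurable_snd).mul (measurable_gibbs hk hφ)).aestronglyMeasurable ?_
  have h1 : ∀ᵐ z ∂(m.prod N), |w z.2| ≤ C := Measure.quasiMeasurePreserving_snd.ae hwC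
  have h2 : ∀ᵐ z ∂(m.prod N), |φ z.2| ≤ B := Measure.quasiMeasurePreserving_snd.ae hφB
  have h3 : ∀ᵐ z ∂(m.prod N), Integrable (fun y => Real.exp (k z.1 y)) N :=
    Measure.quasiMeasurePreserving_fst.ae hkint.prod_right_ae
  filter_upwards [h1, h2, h3] with z hz1 hz2 hz3
  rw [norm_mul, Real.norm_eq_abs, Real.norm_eq_abs, abs_of_pos (Real.exp_pos _)]
  exact mul_le_mul hz1 (exp_sub_logPartition_le hk hk0 hφ hφB hz3 hz2) (Real.exp_pos _).le
    ((abs_nonneg _).trans hz1)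

/-- Concavity and smoothness of the semi-dual on bounded potentials. -/
lemma dualValue_bounds (hk : Measurable (Function.uncurry k)) (hk0 : ∀ x y, 0 ≤ k x y)
    (hkint : Integrable (fun z : α × β => Real.exp (k z.1 z.2)) (m.prod N))
    (hφ : Measurable φ) (hφB : ∀ᵐ y ∂N, |φ y| ≤ B)
    (hψ : Measurable ψ) (hψB : ∀ᵐ y ∂N, |ψ y| ≤ B) :
    dualValue m N k ψ ≤ dualValue m N k φ
        + ∫ y, (1 - gibbsMarginal m N k φ y) * (ψ y - φ y) ∂N ∧
    dualValue m N k φ + (∫ y, (1 - gibbsMarginal m N k φ y) * (ψ y - φ y) ∂N)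
        - Real.exp (2 * B) * (∫ z : α × β, Real.exp (k z.1 z.2) ∂(m.prod N))
          * (∫ y, (ψ y - φ y) ^ 2 ∂N) / 2 ≤ dualValue m N k ψ := by
  have hdiff : ∀ᵐ y ∂N, |ψ y - φ y| ≤ 2 * B := by
    filter_upwards [hφB, hψB] with y h1 h2
    rw [abs_le] at *
    constructor <;> linarith [h1.1, h1.2, h2.1, h2.2]
  have hφi : Integrable φ N := Integrable.of_bound hφ.aestronglyMeasurable B hφB
  have hψi : Integrable ψ N := Integrable.of_bound hψ.aestronglyMeasurable B hψB
  have hjoint := integrable_mul_gibbs hk hk0 hkint hφ hφB (hψ.sub hφ) hdiff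
  have hswap : ∫ x, ∫ y, (ψ y - φ y) * Real.exp (φ y - logPartition N k φ x - k x y) ∂N ∂m
      = ∫ y, (ψ y - φ y) * gibbsMarginal m N k φ y ∂N := by
    rw [integral_integral_swap hjoint]
    simp only [gibbsMarginal, integral_const_mul]
  have hgi : Integrable (fun y => (ψ y - φ y) * gibbsMarginal m N k φ y) N := by
    have := hjoint.integral_prod_right
    simpa only [gibbsMarginal, integral_const_mul, Pi.sub_apply] using this
  have hlin : ∫ y, (1 - gibbsMarginal m N k φ y) * (ψ y - φ y) ∂N
      = (∫ y, ψ y ∂N) - (∫ y, φ y ∂N) - ∫ y, (ψ y - φ y) * gibbsMarginal m N k φ y ∂N := by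
    have hi : Integrable (fun y => ψ y - φ y) N := hψi.sub hφi
    rw [← integral_sub hψi hφi, ← integral_sub hi hgi]
    exact integral_congr_ae (Filter.Eventually.of_forall fun y => by simp; ring)
  have hLφ := integrable_logPartition hk hk0 hkint hφ hφB
  have hLψ := integrable_logPartition hk hk0 hkint hψ hψB
  have hinner : Integrable (fun x => ∫ y, (ψ y - φ y) *
      Real.exp (φ y - logPartition N k φ x - k x y) ∂N) m := hjoint.integral_prod_left
  have hbounds := hkint.prod_right_ae.mono fun x hx =>
    log_integral_exp_bounds hφ hφB hψ hψB hk.of_uncurry_left (hk0 x) hx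
  have hlow := integral_mono_ae (hLφ.add hinner) hLψ (hbounds.mono fun x hx => hx.1)
  have hKi := hkint.integral_prod_left
  have hup := integral_mono_ae hLψ ((hLφ.add hinner).add
    (((hKi.const_mul (Real.exp (2 * B))).mul_const (∫ y, (ψ y - φ y) ^ 2 ∂N)).div_const 2))
    (hbounds.mono fun x hx => hx.2)
  rw [integral_add' hLφ hinner, hswap] at hlow
  rw [integral_add' (hLφ.add hinner) (((hKi.const_mul _).mul_const _).div_const 2),
    integral_add' hLφ hinner, hswap, integral_div, integral_mul_const, integral_const_mul,
    ← integral_prod _ hkint] at hup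
  simp only [dualValue]
  constructor <;> linarith

/-- One step of projected gradient ascent with step size `1 / L` for `L`-smooth concave duals. -/
lemma dualValue_projected_step (hk : Measurable (Function.uncurry k)) (hk0 : ∀ x y, 0 ≤ k x y)
    (hkint : Integrable (fun z : α × β => Real.exp (k z.1 z.2)) (m.prod N))
    {S : Set (β → ℝ)} (hS : Convex ℝ S) (hSB : ∀ ξ ∈ S, Measurable ξ ∧ ∀ᵐ y ∂N, |ξ y| ≤ B)
    {L : ℝ} (hL : L = Real.exp (2 * B) * ∫ z : α × β, Real.exp (k z.1 z.2) ∂(m.prod N))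
    {φ P χ : β → ℝ} (hφ : φ ∈ S) (hP : P ∈ S) (hχ : χ ∈ S)
    (hmin : ∀ ξ ∈ S,
      ∫ y, (P y - (φ y + L⁻¹ * (1 - gibbsMarginal m N k φ y))) ^ 2 ∂N
        ≤ ∫ y, (ξ y - (φ y + L⁻¹ * (1 - gibbsMarginal m N k φ y))) ^ 2 ∂N) :
    dualValue m N k χ - dualValue m N k P
      ≤ L / 2 * ((∫ y, (φ y - χ y) ^ 2 ∂N) - ∫ y, (P y - χ y) ^ 2 ∂N) := by
  have hLpos : 0 < L := hL ▸ mul_pos (Real.exp_pos _) (integral_exp_pos hkint)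
  have hmem : ∀ ξ ∈ S, MemLp ξ 2 N := fun ξ hξ =>
    MemLp.of_bound (hSB ξ hξ).1.aestronglyMeasurable B (hSB ξ hξ).2
  have hG : MemLp (fun y => 1 - gibbsMarginal m N k φ y) 2 N := by
    refine (memLp_const 1).sub (MemLp.of_bound
      (measurable_gibbsMarginal hk (hSB φ hφ).1).aestronglyMeasurable L ?_)
    filter_upwards [(hSB φ hφ).2] with y hy
    rw [Real.norm_eq_abs, abs_of_nonneg (gibbsMarginal_nonneg y), hL]
    exact gibbsMarginal_le hk hk0 hkint (hSB φ hφ).1 (hSB φ hφ).2 hy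
  have hvar := integral_sub_mul_sub_nonneg_of_forall_le hS
    (f := fun y => φ y + L⁻¹ * (1 - gibbsMarginal m N k φ y))
    ((hmem P hP).sub ((hmem φ hφ).add (hG.const_mul _))) ((hmem χ hχ).sub (hmem P hP))
    hP hχ hmin
  have hconc := (dualValue_bounds hk hk0 hkint (hSB φ hφ).1 (hSB φ hφ).2
    (hSB χ hχ).1 (hSB χ hχ).2).1
  have hsmooth := (dualValue_bounds hk hk0 hkint (hSB φ hφ).1 (hSB φ hφ).2
    (hSB P hP).1 (hSB P hP).2).2
  rw [← hL] at hsmooth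
  have i1 : Integrable (fun y => (1 - gibbsMarginal m N k φ y) * (χ y - φ y)) N :=
    hG.integrable_mul ((hmem χ hχ).sub (hmem φ hφ))
  have i2 : Integrable (fun y => (1 - gibbsMarginal m N k φ y) * (P y - φ y)) N :=
    hG.integrable_mul ((hmem P hP).sub (hmem φ hφ))
  have i3 : Integrable (fun y => (φ y - χ y) ^ 2) N := ((hmem φ hφ).sub (hmem χ hχ)).integrable_sq
  have i4 : Integrable (fun y => (P y - χ y) ^ 2) N := ((hmem P hP).sub (hmem χ hχ)).integrable_sq
  have i5 : Integrable (fun y => (P y - φ y) ^ 2) N := ((hmem P hP).sub (hmem φ hφ)).integrable_sq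
  have hid : L * ∫ y, (P y - (φ y + L⁻¹ * (1 - gibbsMarginal m N k φ y))) * (χ y - P y) ∂N
      = L / 2 * ((∫ y, (φ y - χ y) ^ 2 ∂N) - (∫ y, (P y - χ y) ^ 2 ∂N)
          - ∫ y, (P y - φ y) ^ 2 ∂N)
        - ((∫ y, (1 - gibbsMarginal m N k φ y) * (χ y - φ y) ∂N)
          - ∫ y, (1 - gibbsMarginal m N k φ y) * (P y - φ y) ∂N) := by
    have i6 : Integrable (fun y => (φ y - χ y) ^ 2 - (P y - χ y) ^ 2) N := i3.sub i4
    have i7 : Integrable (fun y => L / 2 * ((φ y - χ y) ^ 2 - (P y - χ y) ^ 2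
        - (P y - φ y) ^ 2)) N := (i6.sub i5).const_mul _
    have i8 : Integrable (fun y => (1 - gibbsMarginal m N k φ y) * (χ y - φ y)
        - (1 - gibbsMarginal m N k φ y) * (P y - φ y)) N := i1.sub i2
    rw [← integral_sub i3 i4, ← integral_sub i6 i5, ← integral_sub i1 i2,
      ← integral_const_mul, ← integral_const_mul, ← integral_sub i7 i8]
    refine integral_congr_ae (Filter.Eventually.of_forall fun y => ?_)
    beta_reduce
    field_simp
    ring
  have := mul_nonneg hLpos.le hvar
  rw [hid] at this
  nlinarith

/-- The `O(1/n)` rate of projected gradient ascent for the semi-dual. -/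
lemma dualValue_projected_rate (hk : Measurable (Function.uncurry k)) (hk0 : ∀ x y, 0 ≤ k x y)
    (hkint : Integrable (fun z : α × β => Real.exp (k z.1 z.2)) (m.prod N))
    {S : Set (β → ℝ)} (hS : Convex ℝ S) (hSB : ∀ ξ ∈ S, Measurable ξ ∧ ∀ᵐ y ∂N, |ξ y| ≤ B)
    {L : ℝ} (hL : L = Real.exp (2 * B) * ∫ z : α × β, Real.exp (k z.1 z.2) ∂(m.prod N))
    {φ : ℕ → β → ℝ} {χ : β → ℝ} (hφ : ∀ n, φ n ∈ S) (hχ : χ ∈ S)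
    (hmin : ∀ n, ∀ ξ ∈ S,
      ∫ y, (φ (n + 1) y - (φ n y + L⁻¹ * (1 - gibbsMarginal m N k (φ n) y))) ^ 2 ∂N
        ≤ ∫ y, (ξ y - (φ n y + L⁻¹ * (1 - gibbsMarginal m N k (φ n) y))) ^ 2 ∂N) (n : ℕ) :
    n * (dualValue m N k χ - dualValue m N k (φ n)) ≤ L / 2 * ∫ y, (φ 0 y - χ y) ^ 2 ∂N := by
  have hLpos : 0 < L := hL ▸ mul_pos (Real.exp_pos _) (integral_exp_pos hkint)
  suffices h : n * (dualValue m N k χ - dualValue m N k (φ n))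
      ≤ L / 2 * ((∫ y, (φ 0 y - χ y) ^ 2 ∂N) - ∫ y, (φ n y - χ y) ^ 2 ∂N) by
    have h0 : 0 ≤ ∫ y, (φ n y - χ y) ^ 2 ∂N := integral_nonneg fun _ => sq_nonneg _
    nlinarith
  induction n with
  | zero => simp
  | succ n ih =>
    have hstep := dualValue_projected_step hk hk0 hkint hS hSB hL (hφ n) (hφ (n + 1)) hχ (hmin n)
    have hmono := dualValue_projected_step hk hk0 hkint hS hSB hL (hφ n) (hφ (n + 1)) (hφ n)
      (hmin n)
    have h0 : 0 ≤ ∫ y, (φ (n + 1) y - φ n y) ^ 2 ∂N := integral_nonneg fun _ => sq_nonneg _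
    have hmono' : dualValue m N k (φ n) ≤ dualValue m N k (φ (n + 1)) := by
      simp only [sub_self, ne_eq, OfNat.ofNat_ne_zero, not_false_eq_true, zero_pow,
        integral_zero, zero_sub] at hmono
      nlinarith
    have hn : (n : ℝ) * (dualValue m N k χ - dualValue m N k (φ (n + 1)))
        ≤ n * (dualValue m N k χ - dualValue m N k (φ n)) := by gcongr
    push_cast
    linarith

end ProductMeasure

section Density

variable {μ ν : (Fin d → ℝ) → ℝ} {c : (Fin d → ℝ) → (Fin d → ℝ) → ℝ} {ε B : ℝ}

lemma integral_withDensity_ofReal {α : Type*} [MeasurableSpace α] {κ : Measure α} {ρ : α → ℝ}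
    (hρ : Measurable ρ) (hρ0 : ∀ x, 0 ≤ ρ x) (g : α → ℝ) :
    ∫ x, g x ∂κ.withDensity (fun x => ENNReal.ofReal (ρ x)) = ∫ x, g x * ρ x ∂κ := by
  rw [integral_withDensity_eq_integral_toReal_smul hρ.ennreal_ofReal
    (Filter.Eventually.of_forall fun _ => ENNReal.ofReal_lt_top)]
  simp only [ENNReal.toReal_ofReal (hρ0 _), smul_eq_mul, mul_comm]

lemma isProbabilityMeasure_withDensity_ofReal {α : Type*} [MeasurableSpace α] {κ : Measure α}
    {ρ : α → ℝ} (hρ0 : ∀ x, 0 ≤ ρ x) (hρ1 : ∫ x, ρ x ∂κ = 1) :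
    IsProbabilityMeasure (κ.withDensity fun x => ENNReal.ofReal (ρ x)) := by
  have hint : Integrable ρ κ := by
    by_contra h
    rw [integral_undef h] at hρ1
    exact zero_ne_one hρ1
  constructor
  rw [withDensity_apply _ MeasurableSet.univ, setLIntegral_univ,
    ← ofReal_integral_eq_lintegral_ofReal hint (Filter.Eventually.of_forall hρ0), hρ1,
    ENNReal.ofReal_one]

lemma prod_withDensity_ofReal {α β : Type*} [MeasurableSpace α] [MeasurableSpace β]
    {κ : Measure α} {κ' : Measure β} [SFinite κ] [SFinite κ'] {ρ : α → ℝ} {ρ' : β → ℝ}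
    (hρ : Measurable ρ) (hρ' : Measurable ρ') (hρ0 : ∀ x, 0 ≤ ρ x) :
    (κ.withDensity fun x => ENNReal.ofReal (ρ x)).prod
        (κ'.withDensity fun y => ENNReal.ofReal (ρ' y))
      = (κ.prod κ').withDensity fun z => ENNReal.ofReal (ρ z.1 * ρ' z.2) := by
  rw [prod_withDensity hρ.ennreal_ofReal hρ'.ennreal_ofReal]
  simp only [ENNReal.ofReal_mul (hρ0 _)]

lemma phiPlus_eq_logPartition (hν : Measurable ν) (hν0 : ∀ y, 0 ≤ ν y) (φ : (Fin d → ℝ) → ℝ) :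
    phiPlus ν c ε φ = logPartition (volume.withDensity fun y => ENNReal.ofReal (ν y))
      (fun x y => c x y / ε) φ := by
  ext x
  rw [phiPlus, logPartition, integral_withDensity_ofReal hν hν0]

lemma semiDual_eq_dualValue (hμ : Measurable μ) (hμ0 : ∀ x, 0 ≤ μ x) (hν : Measurable ν)
    (hν0 : ∀ y, 0 ≤ ν y) (φ : (Fin d → ℝ) → ℝ) :
    semiDual μ ν c ε φ = dualValue (volume.withDensity fun x => ENNReal.ofReal (μ x))
      (volume.withDensity fun y => ENNReal.ofReal (ν y)) (fun x y => c x y / ε) φ := by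
  rw [semiDual, dualValue, integral_withDensity_ofReal hν hν0, integral_withDensity_ofReal hμ hμ0,
    phiPlus_eq_logPartition hν hν0]

lemma deltaJ_div_eq (hμ : Measurable μ) (hμ0 : ∀ x, 0 ≤ μ x) (hν : Measurable ν)
    (hν0 : ∀ y, 0 ≤ ν y) (φ : (Fin d → ℝ) → ℝ) {y : Fin d → ℝ} (hy : ν y ≠ 0) :
    deltaJ μ ν c ε φ y / ν y = 1 - gibbsMarginal
      (volume.withDensity fun x => ENNReal.ofReal (μ x))
      (volume.withDensity fun y => ENNReal.ofReal (ν y)) (fun x y => c x y / ε) φ y := by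
  have hpi : piY μ ν c ε φ y = gibbsMarginal (volume.withDensity fun x => ENNReal.ofReal (μ x))
      (volume.withDensity fun y => ENNReal.ofReal (ν y)) (fun x y => c x y / ε) φ y * ν y := by
    simp only [piY, piJoint, gibbsMarginal, integral_withDensity_ofReal hμ hμ0, integral_mul_const,
      phiPlus_eq_logPartition hν hν0]
  rw [deltaJ, hpi]
  field_simp

lemma integral_sq_sub_step_eq (hμ : Measurable μ) (hμ0 : ∀ x, 0 ≤ μ x) (hν : Measurable ν)
    (hν0 : ∀ y, 0 ≤ ν y) (η : ℝ) (φ ξ : (Fin d → ℝ) → ℝ) :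
    ∫ y, (ξ y - (φ y + η * (deltaJ μ ν c ε φ y / ν y))) ^ 2 * ν y =
      ∫ y, (ξ y - (φ y + η * (1 - gibbsMarginal
        (volume.withDensity fun x => ENNReal.ofReal (μ x))
        (volume.withDensity fun y => ENNReal.ofReal (ν y)) (fun x y => c x y / ε) φ y))) ^ 2
        ∂volume.withDensity fun y => ENNReal.ofReal (ν y) := by
  rw [integral_withDensity_ofReal hν hν0]
  refine integral_congr_ae (Filter.Eventually.of_forall fun y => ?_)
  by_cases hy : ν y = 0
  · simp [hy]
  · simp only [deltaJ_div_eq hμ hμ0 hν hν0 φ hy]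

lemma lamB_eq (hμ : Measurable μ) (hμ0 : ∀ x, 0 ≤ μ x) (hν : Measurable ν)
    (hν0 : ∀ y, 0 ≤ ν y) :
    lamB μ ν c ε B = Real.exp (2 * B) * ∫ z : (Fin d → ℝ) × (Fin d → ℝ), Real.exp (c z.1 z.2 / ε)
      ∂(volume.withDensity fun x => ENNReal.ofReal (μ x)).prod
        (volume.withDensity fun y => ENNReal.ofReal (ν y)) := by
  have hρ : Measurable fun z : (Fin d → ℝ) × (Fin d → ℝ) => μ z.1 * ν z.2 := by fun_prop
  rw [lamB, prod_withDensity_ofReal hμ hν hμ0, integral_withDensity_ofReal hρ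
    (fun z => mul_nonneg (hμ0 z.1) (hν0 z.2)), Measure.volume_eq_prod]
  simp only [mul_assoc]

lemma integrable_exp_prod_withDensity (hμ : Measurable μ) (hμ0 : ∀ x, 0 ≤ μ x)
    (hν : Measurable ν) (hν0 : ∀ y, 0 ≤ ν y)
    (h : Integrable
      (fun z : (Fin d → ℝ) × (Fin d → ℝ) => Real.exp (c z.1 z.2 / ε) * μ z.1 * ν z.2)) :
    Integrable (fun z : (Fin d → ℝ) × (Fin d → ℝ) => Real.exp (c z.1 z.2 / ε))
      ((volume.withDensity fun x => ENNReal.ofReal (μ x)).prod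
        (volume.withDensity fun y => ENNReal.ofReal (ν y))) := by
  have hρ : Measurable fun z : (Fin d → ℝ) × (Fin d → ℝ) => μ z.1 * ν z.2 := by fun_prop
  rw [prod_withDensity_ofReal hμ hν hμ0, integrable_withDensity_iff_integrable_smul'
    hρ.ennreal_ofReal
    (Filter.Eventually.of_forall fun _ => ENNReal.ofReal_lt_top)]
  refine h.congr (Filter.Eventually.of_forall fun z => ?_)
  simp only [ENNReal.toReal_ofReal (mul_nonneg (hμ0 z.1) (hν0 z.2)), smul_eq_mul]
  ring

lemma convex_measurable_ae_abs_le {α : Type*} [MeasurableSpace α] (κ : Measure α) (B : ℝ) :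
    Convex ℝ {ψ : α → ℝ | Measurable ψ ∧ ∀ᵐ y ∂κ, |ψ y| ≤ B} := by
  rintro f ⟨hf, hfB⟩ g ⟨hg, hgB⟩ a b ha hb hab
  refine ⟨(hf.const_smul a).add (hg.const_smul b), ?_⟩
  filter_upwards [hfB, hgB] with y h1 h2
  simp only [Pi.add_apply, Pi.smul_apply]
  exact abs_le.2 (convex_Icc (-B) B (abs_le.1 h1) (abs_le.1 h2) ha hb hab)

end Density

/-- Convergence rate of projected semi-dual gradient ascent.
With `φ^{n+1} = M(φ^n; λ(B)⁻¹)`, where `M(φ; η)` is the `L²(ν)`-projection onto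
`S_B = {‖φ‖_∞ ≤ B}` of `φ + η δJ(φ)/ν`, and `φ̃*` a maximizer of `J` over `S_B`,
for every `N ≥ 1`: `φ^N ∈ S_B` and `J(φ^N) − J(φ̃*) ≥ −λ(B)·‖φ⁰ − φ̃*‖²_{L²(ν)}/(2N)`. -/
theorem projSGA_rate
    (μ ν : (Fin d → ℝ) → ℝ) (c : (Fin d → ℝ) → (Fin d → ℝ) → ℝ) (ε : ℝ)
    (hε : 0 < ε) (hμ0 : ∀ x, 0 ≤ μ x) (hν0 : ∀ y, 0 ≤ ν y)
    (hμm : Measurable μ) (hνm : Measurable ν)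
    (hμ1 : (∫ x, μ x) = 1) (hν1 : (∫ y, ν y) = 1)
    (hc : Measurable (Function.uncurry c))
    (hc0 : ∀ x y, 0 ≤ c x y)
    (B : ℝ) (hB : 0 < B)
    (hlamfin : Integrable
      (fun z : (Fin d → ℝ) × (Fin d → ℝ) => Real.exp (c z.1 z.2 / ε) * μ z.1 * ν z.2))
    (SB : Set ((Fin d → ℝ) → ℝ))
    (hSB : SB = {ψ | Measurable ψ ∧ ∀ᵐ y ∂(volume : Measure (Fin d → ℝ)), |ψ y| ≤ B})
    (M : ((Fin d → ℝ) → ℝ) → ℝ → ((Fin d → ℝ) → ℝ))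
    (hM : ∀ ψ ∈ SB, ∀ η : ℝ, 0 < η → M ψ η ∈ SB ∧ ∀ χ ∈ SB,
      (∫ y, (M ψ η y - (ψ y + η * (deltaJ μ ν c ε ψ y / ν y))) ^ 2 * ν y) ≤
        ∫ y, (χ y - (ψ y + η * (deltaJ μ ν c ε ψ y / ν y))) ^ 2 * ν y)
    (φ : ℕ → (Fin d → ℝ) → ℝ)
    (hφ0 : φ 0 ∈ SB)
    (hrec : ∀ n, φ (n + 1) = M (φ n) (lamB μ ν c ε B)⁻¹)
    (φstar : (Fin d → ℝ) → ℝ) (hφstarS : φstar ∈ SB)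
    (hmax : ∀ ψ ∈ SB, semiDual μ ν c ε ψ ≤ semiDual μ ν c ε φstar) :
    ∀ N : ℕ, 1 ≤ N → φ N ∈ SB ∧
      semiDual μ ν c ε (φ N) - semiDual μ ν c ε φstar ≥
        -(lamB μ ν c ε B * ∫ y, (φ 0 y - φstar y) ^ 2 * ν y) / (2 * N) := by
  have hNprob := isProbabilityMeasure_withDensity_ofReal hν0 hν1
  have hmprob := isProbabilityMeasure_withDensity_ofReal hμ0 hμ1
  have hexp := integrable_exp_prod_withDensity hμm hμ0 hνm hν0 hlamfin
  have hlam := lamB_eq (c := c) (ε := ε) (B := B) hμm hμ0 hνm hν0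
  have hlampos : 0 < lamB μ ν c ε B :=
    hlam ▸ mul_pos (Real.exp_pos _) (integral_exp_pos hexp)
  have hmem : ∀ n, φ n ∈ SB := by
    intro n
    induction n with
    | zero => exact hφ0
    | succ n ih => exact hrec n ▸ (hM _ ih _ (inv_pos.2 hlampos)).1
  have hk : Measurable (Function.uncurry fun x y => c x y / ε) := hc.div_const ε
  have hconv : Convex ℝ SB := hSB ▸ convex_measurable_ae_abs_le volume B
  have hbdd : ∀ ξ ∈ SB, Measurable ξ ∧
      ∀ᵐ y ∂volume.withDensity fun y => ENNReal.ofReal (ν y), |ξ y| ≤ B := by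
    intro ξ hξ
    rw [hSB] at hξ
    exact ⟨hξ.1, withDensity_absolutelyContinuous _ _ hξ.2⟩
  intro N hN
  refine ⟨hmem N, ?_⟩
  have hrate := dualValue_projected_rate (k := fun x y => c x y / ε) hk
    (fun x y => div_nonneg (hc0 x y) hε.le) hexp hconv hbdd hlam hmem hφstarS (fun n ξ hξ => by
      rw [← integral_sq_sub_step_eq hμm hμ0 hνm hν0, ← integral_sq_sub_step_eq hμm hμ0 hνm hν0,
        hrec n]
      exact (hM _ (hmem n) _ (inv_pos.2 hlampos)).2 ξ hξ) N
  rw [← semiDual_eq_dualValue hμm hμ0 hνm hν0, ← semiDual_eq_dualValue hμm hμ0 hνm hν0,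
    integral_withDensity_ofReal hνm hν0] at hrate
  have hNpos : (0 : ℝ) < N := by exact_mod_cast hN
  rw [ge_iff_le, div_le_iff₀ (by positivity)]
  linarith
end
end
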